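/- Let Γ₀ = F₂, Γ_n = Γ_{n−1}^{(2)} for n ≥ 1, and X_n the Cayley graph of F₂/Γ_n; each X_n (n ≥ 1) is the ℤ/2-homology cover of X_{n−1} and carries the wall metric d_{W_n}. Let (X, d_X) and (X, d_W) be the coarse disjoint unions of the (X_n, d_{X_n}) and (X_n, d_{W_n}) respectively. Then the identity map id : (X, d_X) → (X, d_W) is a coarse equivalence; more precisely, id is 1-Lipschitz, and for every R ≥ 0 there exists S ≥ 0 such that for all x, y ∈ X, d_W(x,y) ≤ R implies d_X(x,y) ≤ S. -/

import Mathlib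

/-- A multigraph: a set of vertices `V`, a set of edges `E`, and two endpoint maps.
The pair `(src e, tgt e)` records an (arbitrary) orientation of the unoriented edge `e`;
graphs are regarded as unoriented. -/
structure Multigraph (V E : Type) where
  src : E → V
  tgt : E → V

namespace Multigraph

variable {V E : Type}

/-- The edge `e` is an edge between `u` and `v` (in either direction). -/
def EndsAt (G : Multigraph V E) (e : E) (u v : V) : Prop :=
  (G.src e = u ∧ G.tgt e = v) ∨ (G.src e = v ∧ G.tgt e = u)

/-- A path (walk) in a multigraph from `u` to `v`: a sequence
`(v₀, e₁, v₁, …, e_n, v_n)` where each `e_i` is an edge between `v_{i-1}` and `v_i`. -/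
inductive Walk (G : Multigraph V E) : V → V → Type
  | nil (v : V) : Walk G v v
  | cons {u v w : V} (e : E) (h : G.EndsAt e u v) (p : Walk G v w) : Walk G u w

namespace Walk

variable {G : Multigraph V E}

/-- The length of a path. -/
def length : ∀ {u v : V}, G.Walk u v → ℕ
  | _, _, .nil _ => 0
  | _, _, .cons _ _ p => length p + 1

/-- The list of edges of a path. -/
def edges : ∀ {u v : V}, G.Walk u v → List E
  | _, _, .nil _ => []
  | _, _, .cons e _ p => e :: edges p

/-- The list of vertices of a path (including the first one). -/
def verts : ∀ {u v : V}, G.Walk u v → List V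
  | _, _, .nil v => [v]
  | u, _, .cons _ _ p => u :: verts p

/-- A path has a backtrack if for some `i` it traverses the same edge at steps
`i+1` and `i+2` returning to the same vertex, i.e. `v_i = v_{i+2}` and `e_{i+1} = e_{i+2}`. -/
def HasBacktrack {u v : V} (p : G.Walk u v) : Prop :=
  ∃ i : ℕ, i + 1 < p.edges.length ∧ p.edges[i]? = p.edges[i + 1]? ∧
    p.verts[i]? = p.verts[i + 2]?

end Walk

/-- A multigraph is connected if any two vertices are joined by a path. -/
def Connected (G : Multigraph V E) : Prop := ∀ u v : V, Nonempty (G.Walk u v)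

/-- `u` and `v` can be joined by a path avoiding all edges in `F`. -/
def ReachAvoid (G : Multigraph V E) (F : Set E) (u v : V) : Prop :=
  ∃ p : G.Walk u v, ∀ e ∈ p.edges, e ∉ F

/-- A set of edges `w` is a wall (a cut) if removing these edges from the graph separates
it into exactly two connected components (the associated half-spaces `A` and `B`). -/
def IsWall (G : Multigraph V E) (w : Set E) : Prop :=
  ∃ A B : Set V, A.Nonempty ∧ B.Nonempty ∧ Disjoint A B ∧ A ∪ B = Set.univ ∧
    ∀ u v : V, G.ReachAvoid w u v ↔ ((u ∈ A ∧ v ∈ A) ∨ (u ∈ B ∧ v ∈ B))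

/-- A wall structure: a set of walls such that every edge belongs to exactly one wall. -/
def IsWallStructure (G : Multigraph V E) (W : Set (Set E)) : Prop :=
  (∀ w ∈ W, G.IsWall w) ∧ ∀ e : E, ∃! w, w ∈ W ∧ e ∈ w

/-- The set of edges `w` separates `u` from `v` if after removing `w` there is
no path from `u` to `v` (i.e. they lie in different half-spaces). -/
def Separates (G : Multigraph V E) (w : Set E) (u v : V) : Prop :=
  ¬ G.ReachAvoid w u v

/-- The wall pseudometric associated with a wall structure `W`:
the number of walls of `W` separating `x` from `y`. -/
noncomputable def wallDistOf (G : Multigraph V E) (W : Set (Set E)) (x y : V) : ℕ :=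
  {w : Set E | w ∈ W ∧ G.Separates w x y}.ncard

/-- The graph metric: the length of a shortest path between two vertices. -/
noncomputable def graphDist (G : Multigraph V E) (u v : V) : ℕ :=
  sInf {n : ℕ | ∃ p : G.Walk u v, p.length = n}

/-- A simple loop: a closed path of positive length with no repeated edges and no
repeated vertices (except that the first and last vertex coincide). -/
def IsSimpleLoop (G : Multigraph V E) {v : V} (p : G.Walk v v) : Prop :=
  0 < p.length ∧ p.edges.Nodup ∧ p.verts.dropLast.Nodup

/-- The girth of a multigraph: the length of a shortest simple loop. -/
noncomputable def girth (G : Multigraph V E) : ℕ :=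
  sInf {n : ℕ | ∃ (v : V) (p : G.Walk v v), G.IsSimpleLoop p ∧ p.length = n}

end Multigraph

namespace Multigraph

variable {V E : Type}

/-- A graph is 2-connected if removing any single edge does not disconnect it
(equivalently, every edge lies on a simple loop). -/
def TwoConnected (G : Multigraph V E) : Prop :=
  G.Connected ∧ ∀ (e : E) (u v : V), G.ReachAvoid {e} u v

/-- `T` is (the edge set of) a spanning tree of the finite graph `G`: the edges of `T`
connect all vertices of `G` and `|T| = |V(G)| - 1` (so the subgraph on `T` is a tree). -/
def IsSpanningTree [Fintype V] (G : Multigraph V E) (T : Finset E) : Prop :=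
  (∀ u v : V, ∃ p : G.Walk u v, ∀ e ∈ p.edges, e ∈ T) ∧ T.card + 1 = Fintype.card V

variable [Fintype E] [DecidableEq E]

/-- Given a spanning tree `T` with `S = E \ T = Tᶜ`, crossing the edge `e` changes the
second coordinate `τ ⊆ S` of a vertex of the `ℤ/2`-homology cover to `τ △ {e}` if `e ∈ S`,
and leaves it unchanged if `e ∈ T`. -/
def tauStep (T : Finset E) (e : E) (τ : {τ : Finset E // τ ⊆ Tᶜ}) :
    {τ : Finset E // τ ⊆ Tᶜ} :=
  if he : e ∈ Tᶜ then
    ⟨symmDiff τ.1 {e}, fun x hx => by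
      rcases Finset.mem_symmDiff.mp hx with ⟨h1, _⟩ | ⟨h1, _⟩
      · exact τ.2 h1
      · rwa [Finset.mem_singleton.mp h1]⟩
  else τ

/-- The `ℤ/2`-homology cover of `G` associated with the spanning tree `T` (with
`S = Tᶜ`): vertices are `V × 𝒫(S)`, edges are `E × 𝒫(S)`, where the edge `(e, τ)`
joins `(x, τ)` to `(y, τ)` if `e ∉ S`, and `(x, τ)` to `(y, τ △ {e})` if `e ∈ S`
with the orientation `x → y`. -/
def cover (G : Multigraph V E) (T : Finset E) :
    Multigraph (V × {τ : Finset E // τ ⊆ Tᶜ}) (E × {τ : Finset E // τ ⊆ Tᶜ}) where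
  src p := (G.src p.1, p.2)
  tgt p := (G.tgt p.1, tauStep T p.1 p.2)

/-- The covering projection maps paths in the cover to paths in the base graph,
forgetting the second coordinates. -/
def projWalk {G : Multigraph V E} {T : Finset E} :
    ∀ {x y : V × {τ : Finset E // τ ⊆ Tᶜ}}, (cover G T).Walk x y → G.Walk x.1 y.1
  | _, _, .nil v => .nil v.1
  | _, _, .cons e h p =>
      .cons e.1
        (by
          rcases h with ⟨h1, h2⟩ | ⟨h1, h2⟩
          · exact Or.inl ⟨congrArg Prod.fst h1, congrArg Prod.fst h2⟩
          · exact Or.inr ⟨congrArg Prod.fst h1, congrArg Prod.fst h2⟩)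
        (projWalk p)

/-- A path `p` in `G` from `x₀` to `y₀` is `(x,y)`-admissible (for vertices
`x = (x₀, τ_x)`, `y = (y₀, τ_y)` of the cover) if for every `e ∈ S = Tᶜ`, the number
of occurrences of `e` among the edges of `p` is odd when `e ∈ τ_x △ τ_y` and even
otherwise. -/
def Admissible (G : Multigraph V E) (T : Finset E)
    (x y : V × {τ : Finset E // τ ⊆ Tᶜ}) (p : G.Walk x.1 y.1) : Prop :=
  ∀ e ∈ (Tᶜ : Finset E),
    p.edges.count e % 2 = if e ∈ symmDiff x.2.1 y.2.1 then 1 else 0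

/-- The wall `w_e = π⁻¹(e)` of the `ℤ/2`-homology cover associated to an edge `e` of
the base graph. -/
def wallOf (G : Multigraph V E) (T : Finset E) (e : E) :
    Set (E × {τ : Finset E // τ ⊆ Tᶜ}) := {f | f.1 = e}

/-- The wall metric on the `ℤ/2`-homology cover: the number of walls
`w_e = π⁻¹(e)`, `e ∈ E(G)`, separating `x` from `y`. -/
noncomputable def wallDist (G : Multigraph V E) (T : Finset E)
    (x y : V × {τ : Finset E // τ ⊆ Tᶜ}) : ℕ :=
  {e : E | (cover G T).Separates (wallOf G T e) x y}.ncard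

end Multigraph

open Multigraph

/-- A finite multigraph with decidable equality, bundled. -/
structure Lv where
  V : Type
  E : Type
  G : Multigraph V E
  fV : Fintype V
  fE : Fintype E
  dV : DecidableEq V
  dE : DecidableEq E

/-- A choice of a spanning tree of `G` (when one exists). -/
noncomputable def chooseTree {V E : Type} [Fintype V] [Fintype E] (G : Multigraph V E) :
    Finset E :=
  letI := Classical.dec (∃ T : Finset E, G.IsSpanningTree T)
  if h : ∃ T : Finset E, G.IsSpanningTree T then h.choose else ∅

/-- The `ℤ/2`-homology cover of a bundled finite multigraph, with respect to the chosen
spanning tree. -/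
noncomputable def Lv.next (L : Lv) : Lv :=
  letI := L.fV; letI := L.fE; letI := L.dV; letI := L.dE
  { V := L.V × {τ : Finset L.E // τ ⊆ (chooseTree L.G)ᶜ}
    E := L.E × {τ : Finset L.E // τ ⊆ (chooseTree L.G)ᶜ}
    G := cover L.G (chooseTree L.G)
    fV := inferInstance
    fE := inferInstance
    dV := inferInstance
    dE := inferInstance }

/-- The "figure eight" graph: one vertex and two (self-loop) edges. -/
def figureEight : Lv :=
  { V := Unit
    E := Fin 2
    G := { src := fun _ => (), tgt := fun _ => () }
    fV := inferInstance
    fE := inferInstance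
    dV := inferInstance
    dE := inferInstance }

/-- The tower `X₀ = ` figure eight, `X_{n+1} = ` the `ℤ/2`-homology cover of `X_n`;
so `X_n` is the Cayley graph of `F₂/Γ_n`. -/
noncomputable def lv : ℕ → Lv := fun n => Nat.rec figureEight (fun _ L => L.next) n

/-- The graph metric `d_{X_n}` on `X_n`. -/
noncomputable def graphDistAt (n : ℕ) : (lv n).V → (lv n).V → ℕ :=
  fun x y => graphDist (lv n).G x y

/-- The wall metric `d_{W_n}` on `X_n`, coming from `X_n` being the
`ℤ/2`-homology cover of `X_{n-1}` (and trivial on the one-point graph `X₀`). -/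
noncomputable def wallDistAt : (n : ℕ) → (lv n).V → (lv n).V → ℕ
  | 0 => fun _ _ => 0
  | n + 1 => fun x y =>
      letI := (lv n).fV; letI := (lv n).fE; letI := (lv n).dV; letI := (lv n).dE
      wallDist (lv n).G (chooseTree (lv n).G) x y

/-- The diameter of `(X_n, d_{X_n})`. -/
noncomputable def diamX (n : ℕ) : ℕ := sSup {k : ℕ | ∃ x y, graphDistAt n x y = k}

/-- The diameter of `(X_n, d_{W_n})`. -/
noncomputable def diamW (n : ℕ) : ℕ := sSup {k : ℕ | ∃ x y, wallDistAt n x y = k}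

/-- The box space `X = ⊔ X_n` (as a set). -/
def BoxV : Type := Σ n : ℕ, (lv n).V

/-- The metric `d_X` of the coarse disjoint union `(X, d_X) = ⊔ (X_n, d_{X_n})`. -/
noncomputable def boxDistX (p q : BoxV) : ℕ :=
  if h : p.1 = q.1 then graphDistAt q.1 (h ▸ p.2) q.2
  else diamX p.1 + diamX q.1 + p.1 + q.1

/-- The metric `d_W` of the coarse disjoint union `(X, d_W) = ⊔ (X_n, d_{W_n})`. -/
noncomputable def boxDistW (p q : BoxV) : ℕ :=
  if h : p.1 = q.1 then wallDistAt q.1 (h ▸ p.2) q.2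
  else diamW p.1 + diamW q.1 + p.1 + q.1

namespace BoxAux

open Multigraph

variable {V E : Type}

/-- mod 2 boundary of an edge. -/
noncomputable def dE (G : Multigraph V E) (e : E) : V →₀ ZMod 2 :=
  Finsupp.single (G.src e) 1 + Finsupp.single (G.tgt e) 1

/-- mod 2 boundary of a multiset of edges. -/
noncomputable def bd (G : Multigraph V E) (m : Multiset E) : V →₀ ZMod 2 :=
  (m.map (dE G)).sum

/-- vertex chain -/
noncomputable abbrev dl (v : V) : V →₀ ZMod 2 := Finsupp.single v 1

lemma add_self2 (c : V →₀ ZMod 2) : c + c = 0 := by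
  ext v; simp [CharTwo.add_self_eq_zero]

lemma eq_of_add2 {a b : V →₀ ZMod 2} (h : a + b = 0) : a = b := by
  have : a + b + b = b := by rw [h, zero_add]
  rwa [add_assoc, add_self2, add_zero] at this

lemma dE_of_ends {G : Multigraph V E} {e : E} {u v : V} (h : G.EndsAt e u v) :
    dE G e = dl u + dl v := by
  rcases h with ⟨rfl, rfl⟩ | ⟨rfl, rfl⟩
  · rfl
  · exact add_comm _ _

lemma bd_cons (G : Multigraph V E) (e : E) (m : Multiset E) :
    bd G (e ::ₘ m) = dE G e + bd G m := by simp [bd]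

lemma bd_add (G : Multigraph V E) (m m' : Multiset E) :
    bd G (m + m') = bd G m + bd G m' := by simp [bd]

lemma bd_walk {G : Multigraph V E} {u v : V} (p : G.Walk u v) :
    bd G (p.edges : Multiset E) = dl u + dl v := by
  induction p with
  | nil v => simp [Walk.edges, bd, add_self2]
  | @cons u v w e h p ih =>
    rw [Walk.edges, ← Multiset.cons_coe, bd_cons, ih, dE_of_ends h, add_assoc,
      ← add_assoc (dl v), add_self2, zero_add]

lemma length_edges {G : Multigraph V E} {u v : V} (p : G.Walk u v) :
    p.edges.length = p.length := by
  induction p with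
  | nil v => rfl
  | cons e h p ih => simp [Walk.edges, Walk.length, ih]

/-- Trail extraction. -/
lemma trail (G : Multigraph V E) (k : ℕ) : ∀ (m : Multiset E) (x y : V), m.card = k →
    bd G m = dl x + dl y → ∃ q : G.Walk x y, (q.edges : Multiset E) ≤ m := by
  classical
  induction k with
  | zero =>
    intro m x y hm h
    rw [Multiset.card_eq_zero] at hm
    subst hm
    have : dl x = dl y := eq_of_add2 (by rw [← h]; simp [bd])
    have hxy : x = y := Finsupp.single_left_injective (one_ne_zero) this
    subst hxy
    exact ⟨.nil x, by simp [Walk.edges]⟩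
  | succ k ih =>
    intro m x y hm h
    by_cases hxy : x = y
    · subst hxy
      exact ⟨.nil x, by simp [Walk.edges]⟩
    have h1 : bd G m x = 1 := by rw [h]; simp [Finsupp.single_apply, Ne.symm hxy]
    have : ∃ e ∈ m, dE G e x ≠ 0 := by
      by_contra hc
      push Not at hc
      have : bd G m x = 0 := by
        have h2 : bd G m x = (m.map (fun e => dE G e x)).sum := by
          clear hm h h1 hc
          induction m using Multiset.induction_on with
          | empty => simp [bd]
          | cons a s ih => simp [bd_cons, ih]
        rw [h2]
        apply Multiset.sum_eq_zero
        intro c hc'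
        obtain ⟨e, he, rfl⟩ := Multiset.mem_map.1 hc'
        exact hc e he
      rw [this] at h1
      exact zero_ne_one h1
    obtain ⟨e, he, hex⟩ := this
    have : ∃ x', G.EndsAt e x x' := by
      by_cases h1 : G.src e = x
      · exact ⟨_, Or.inl ⟨h1, rfl⟩⟩
      by_cases h2 : G.tgt e = x
      · exact ⟨_, Or.inr ⟨rfl, h2⟩⟩
      exact absurd (by simp [dE, Finsupp.single_apply, h1, h2]) hex
    obtain ⟨x', hx'⟩ := this
    have hm' := Multiset.cons_erase he
    have hb : bd G (m.erase e) = dl x' + dl y := by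
      rw [← hm', bd_cons, dE_of_ends hx', add_assoc] at h
      have h2 := add_left_cancel h
      rw [← h2, ← add_assoc, add_self2, zero_add]
    obtain ⟨q, hq⟩ := ih (m.erase e) x' y (by rw [Multiset.card_erase_of_mem he, hm]; rfl) hb
    refine ⟨.cons e hx' q, ?_⟩
    rw [Walk.edges, ← Multiset.cons_coe, ← hm']
    exact Multiset.cons_le_cons _ hq

lemma bd_eq [Fintype E] [DecidableEq E] (G : Multigraph V E) (m : Multiset E) :
    bd G m = ∑ e, (m.count e : ZMod 2) • dE G e := by
  rw [bd, Finset.sum_multiset_map_count]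
  rw [Finset.sum_subset (Finset.subset_univ _)]
  · simp [Nat.cast_smul_eq_nsmul]
  · intro e _ he
    rw [Multiset.count_eq_zero.2 (by simpa using he), zero_smul]

/-- the family used for the rank computation -/
noncomputable def fam (G : Multigraph V E) (T : Finset E) (v0 : V) : Option T → (V →₀ ZMod 2) :=
  fun o => o.elim (dl v0) (fun e => dE G e)

lemma fam_span [Fintype V] (G : Multigraph V E) (T : Finset E) (v0 : V)
    (hT : ∀ u v : V, ∃ p : G.Walk u v, ∀ e ∈ p.edges, e ∈ T) :
    ⊤ ≤ Submodule.span (ZMod 2) (Set.range (fam G T v0)) := by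
  set S := Submodule.span (ZMod 2) (Set.range (fam G T v0))
  have h0 : dl v0 ∈ S := Submodule.subset_span ⟨none, rfl⟩
  have h1 : ∀ e ∈ T, dE G e ∈ S := fun e he => Submodule.subset_span ⟨some ⟨e, he⟩, rfl⟩
  have h2 : ∀ v, dl v ∈ S := by
    intro v
    obtain ⟨p, hp⟩ := hT v0 v
    have h3 := bd_walk p
    have h4 : bd G (p.edges : Multiset E) ∈ S := by
      refine multiset_sum_mem _ ?_
      intro a ha
      obtain ⟨e, he, rfl⟩ := Multiset.mem_map.1 ha
      exact h1 e (hp e (by simpa using he))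
    rw [h3] at h4
    exact (Submodule.add_mem_iff_right S h0).1 h4
  intro c _
  induction c using Finsupp.induction_linear with
  | zero => exact S.zero_mem
  | add f g hf hg => exact S.add_mem (hf trivial) (hg trivial)
  | single a b =>
    have := S.smul_mem b (h2 a)
    simpa using this

lemma tree_indep [Fintype V] [Fintype E] {G : Multigraph V E} {T : Finset E}
    (hT : G.IsSpanningTree T) (c : E → ZMod 2) (hc : ∀ e, e ∉ T → c e = 0)
    (h : ∑ e, c e • dE G e = 0) (e : E) : c e = 0 := by
  classical
  by_cases he : e ∈ T
  swap
  · exact hc e he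
  have hli : LinearIndependent (ZMod 2) (fam G T (G.src e)) := by
    apply linearIndependent_of_top_le_span_of_card_eq_finrank (fam_span G T _ hT.1)
    simp [hT.2]
  have hli2 : LinearIndependent (ZMod 2) (fun t : T => dE G t) :=
    hli.comp (some : T → Option T) (Option.some_injective _)
  rw [Fintype.linearIndependent_iff] at hli2
  refine hli2 (fun t => c t) ?_ ⟨e, he⟩
  rw [Finset.sum_coe_sort T (fun e => c e • dE G e), ← h]
  apply Finset.sum_subset (Finset.subset_univ _)
  intro x _ hx
  rw [hc x hx, zero_smul]

lemma exists_tree [Fintype V] [Fintype E] (G : Multigraph V E) [Nonempty V] (hG : G.Connected) :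
    ∃ T : Finset E, G.IsSpanningTree T := by
  classical
  obtain ⟨v0⟩ := ‹Nonempty V›
  obtain ⟨T, hTs, hTi⟩ : ∃ T : Finset E,
      Submodule.span (ZMod 2) (Set.range (fun t : T => dE G t)) =
        Submodule.span (ZMod 2) (Set.range (dE G)) ∧
      LinearIndependent (ZMod 2) (fun t : T => dE G t) := by
    obtain ⟨κ, a, ha, hs, hi⟩ := exists_linearIndependent' (ZMod 2) (dE G)
    haveI : Finite κ := Finite.of_injective a ha
    haveI := Fintype.ofFinite κ
    let T : Finset E := Finset.univ.image a
    have hmem : ∀ t : T, ∃ k, a k = t := fun t => by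
      obtain ⟨k, _, hk⟩ := Finset.mem_image.1 t.2
      exact ⟨k, hk⟩
    choose b hb using hmem
    refine ⟨T, ?_, ?_⟩
    · rw [← hs]
      congr 1
      ext c
      constructor
      · rintro ⟨t, rfl⟩
        exact ⟨b t, by simp [hb]⟩
      · rintro ⟨k, rfl⟩
        exact ⟨⟨a k, by simp [T]⟩, rfl⟩
    · have hbi : Function.Injective b := fun s t hst => by
        apply Subtype.ext
        rw [← hb, ← hb, hst]
      have := hi.comp b hbi
      have heq : (fun t : T => dE G t) = (dE G ∘ a) ∘ b := by
        funext t
        simp [hb]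
      rw [heq]
      exact this
  have hconn : ∀ u v : V, ∃ p : G.Walk u v, ∀ e ∈ p.edges, e ∈ T := by
    intro u v
    obtain ⟨p⟩ := hG u v
    have h1 : dl u + dl v ∈ Submodule.span (ZMod 2) (Set.range (fun t : T => dE G t)) := by
      rw [hTs, ← bd_walk p]
      refine multiset_sum_mem _ ?_
      intro a ha
      obtain ⟨e, he, rfl⟩ := Multiset.mem_map.1 ha
      exact Submodule.subset_span ⟨e, rfl⟩
    have key : ∀ c ∈ Submodule.span (ZMod 2) (Set.range (fun t : T => dE G t)),
        ∃ m : Multiset E, (∀ e ∈ m, e ∈ T) ∧ bd G m = c := by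
      intro c hc
      induction hc using Submodule.span_induction with
      | mem x h =>
        obtain ⟨t, rfl⟩ := h
        exact ⟨{t.1}, by simp, by simp [bd]⟩
      | zero => exact ⟨0, by simp, by simp [bd]⟩
      | add x y _ _ hx hy =>
        obtain ⟨m, hm, rfl⟩ := hx
        obtain ⟨m', hm', rfl⟩ := hy
        refine ⟨m + m', ?_, bd_add _ _ _⟩
        intro e he
        rcases Multiset.mem_add.1 he with h | h
        · exact hm e h
        · exact hm' e h
      | smul a x _ hx =>
        obtain ⟨m, hm, rfl⟩ := hx
        have : a = 0 ∨ a = 1 := by revert a; decide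
        rcases this with rfl | rfl
        · exact ⟨0, by simp, by simp [bd]⟩
        · exact ⟨m, hm, by simp⟩
    obtain ⟨m, hm, hb⟩ := key _ h1
    obtain ⟨q, hq⟩ := trail G _ m u v rfl hb
    exact ⟨q, fun e he => hm e (Multiset.mem_of_le hq (by simpa using he))⟩
  refine ⟨T, hconn, ?_⟩
  have hsum : ∀ c ∈ Submodule.span (ZMod 2) (Set.range (fun t : T => dE G t)),
      Finsupp.linearCombination (ZMod 2) (fun _ : V => (1 : ZMod 2)) c = 0 := by
    intro c hc
    induction hc using Submodule.span_induction with
    | mem x h =>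
      obtain ⟨t, rfl⟩ := h
      simp [dE, CharTwo.add_self_eq_zero]
    | zero => simp
    | add x y _ _ hx hy => simp [hx, hy]
    | smul a x _ hx => simp [hx]
  have hni : dl v0 ∉ Submodule.span (ZMod 2) (Set.range (fun t : T => dE G t)) := by
    intro h
    have := hsum _ h
    simp at this
  have hli : LinearIndependent (ZMod 2) (fam G T v0) := by
    have := hTi.option hni
    have heq : fam G T v0 = fun o => Option.casesOn' o (dl v0) (fun t : T => dE G t) := by
      funext o
      cases o <;> rfl
    rw [heq]
    exact this
  have hb := Module.finrank_eq_card_basis (Module.Basis.mk hli (fam_span G T v0 hconn))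
  simp at hb
  omega

/-! ### the cover -/

section cover

variable [Fintype E] [DecidableEq E] {G : Multigraph V E} {T : Finset E}

lemma mem_tauStep (e e' : E) (τ : {τ : Finset E // τ ⊆ Tᶜ}) :
    e' ∈ (tauStep T e τ).1 ↔ (if e = e' ∧ e ∉ T then e' ∉ τ.1 else e' ∈ τ.1) := by
  unfold tauStep
  split_ifs with h1 h2 h2
  · obtain ⟨rfl, h2⟩ := h2
    simp [Finset.mem_symmDiff]
  · have : e ≠ e' := fun h => h2 ⟨h, by simpa using h1⟩
    simp [Finset.mem_symmDiff, this.symm]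
  · simp at h1
    exact absurd h1 h2.2
  · rfl

lemma tauStep_invol (e : E) (τ : {τ : Finset E // τ ⊆ Tᶜ}) :
    tauStep T e (tauStep T e τ) = τ := by
  apply Subtype.ext
  ext a
  rw [mem_tauStep, mem_tauStep]
  split_ifs <;> simp

lemma tauStep_inj (e : E) {τ τ' : {τ : Finset E // τ ⊆ Tᶜ}}
    (h : tauStep T e τ = tauStep T e τ') : τ = τ' := by
  rw [← tauStep_invol e τ, h, tauStep_invol]

lemma edges_projWalk {x y} (p : (cover G T).Walk x y) :
    (projWalk p).edges = p.edges.map Prod.fst := by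
  induction p with
  | nil v => rfl
  | cons e h p ih => simp [projWalk, Walk.edges, ih]

lemma bd_proj {x y} (p : (cover G T).Walk x y) :
    bd G ((p.edges.map Prod.fst : List E) : Multiset E) = dl x.1 + dl y.1 := by
  rw [← edges_projWalk, bd_walk]

/-- indicator -/
def ind (e : E) (τ : {τ : Finset E // τ ⊆ Tᶜ}) : ZMod 2 := if e ∈ τ.1 then 1 else 0

lemma ind_tauStep (e e' : E) (τ : {τ : Finset E // τ ⊆ Tᶜ}) (h : e' ∉ T) :
    ind e' (tauStep T e τ) = ind e' τ + (if e = e' then 1 else 0) := by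
  unfold ind
  rw [if_congr (mem_tauStep e e' τ) rfl rfl]
  by_cases h1 : e = e'
  · subst h1
    by_cases h2 : e ∈ τ.1 <;> simp [h, h2, CharTwo.add_self_eq_zero]
  · simp [h1]

lemma count_proj {x y} (p : (cover G T).Walk x y) (e : E) (he : e ∉ T) :
    (((p.edges.map Prod.fst).count e : ℕ) : ZMod 2) = ind e x.2 + ind e y.2 := by
  induction p with
  | nil v => simp [Walk.edges, CharTwo.add_self_eq_zero]
  | @cons u v w f h p ih =>
    have h1 : ind e u.2 = ind e v.2 + (if f.1 = e then 1 else 0) := by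
      rcases h with ⟨rfl, rfl⟩ | ⟨rfl, rfl⟩
      · simp only [cover]
        rw [ind_tauStep _ _ _ he, add_assoc, CharTwo.add_self_eq_zero, add_zero]
      · simp only [cover]
        rw [ind_tauStep _ _ _ he]
    simp only [Walk.edges, List.map_cons, List.count_cons, Nat.cast_add, ih, h1, beq_iff_eq]
    split_ifs <;> simp <;> ring

lemma parity [Fintype V] (hT : G.IsSpanningTree T) {x y} (p p' : (cover G T).Walk x y) (e : E) :
    (((p.edges.map Prod.fst).count e : ℕ) : ZMod 2) =
      (((p'.edges.map Prod.fst).count e : ℕ) : ZMod 2) := by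
  have h1 := bd_proj p
  have h2 := bd_proj p'
  rw [bd_eq] at h1 h2
  have := tree_indep hT (fun e => (((p.edges.map Prod.fst).count e : ℕ) : ZMod 2) -
      (((p'.edges.map Prod.fst).count e : ℕ) : ZMod 2)) ?_ ?_ e
  · exact sub_eq_zero.1 this
  · intro e he
    rw [count_proj p e he, count_proj p' e he, sub_self]
  · simp only [Multiset.coe_count] at h1 h2
    simp only [sub_smul, Finset.sum_sub_distrib]
    rw [h1, h2, sub_self]

lemma lift {u v : V} (q : G.Walk u v) : ∀ τ : {τ : Finset E // τ ⊆ Tᶜ},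
    ∃ (τ' : {τ : Finset E // τ ⊆ Tᶜ}) (p : (cover G T).Walk (u, τ) (v, τ')),
      p.edges.map Prod.fst = q.edges := by
  induction q with
  | nil v => exact fun τ => ⟨τ, .nil _, rfl⟩
  | @cons u v w e h q ih =>
    intro τ
    obtain ⟨τ', p, hp⟩ := ih (tauStep T e τ)
    refine ⟨τ', ?_⟩
    rcases h with ⟨rfl, rfl⟩ | ⟨rfl, rfl⟩
    · exact ⟨.cons (e, τ) (Or.inl ⟨rfl, rfl⟩) p, congrArg (List.cons e) hp⟩
    · have hends : (cover G T).EndsAt (e, tauStep T e τ) (G.tgt e, τ)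
          (G.src e, tauStep T e τ) := Or.inr ⟨rfl, by simp [cover, tauStep_invol]⟩
      exact ⟨.cons (e, tauStep T e τ) hends p, congrArg (List.cons e) hp⟩

end cover

/-- concatenation -/
def app {G : Multigraph V E} : ∀ {u v w : V}, G.Walk u v → G.Walk v w → G.Walk u w
  | _, _, _, .nil _, q => q
  | _, _, _, .cons e h p, q => .cons e h (app p q)

lemma reach_trans {G : Multigraph V E} {u v w : V} (h : Nonempty (G.Walk u v))
    (h' : Nonempty (G.Walk v w)) : Nonempty (G.Walk u w) := by
  obtain ⟨p⟩ := h
  obtain ⟨q⟩ := h'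
  exact ⟨app p q⟩

lemma reach_symm {G : Multigraph V E} {u v : V} (h : Nonempty (G.Walk u v)) :
    Nonempty (G.Walk v u) := by
  obtain ⟨p⟩ := h
  induction p with
  | nil v => exact ⟨.nil v⟩
  | cons e h p ih => exact reach_trans ih ⟨.cons e h.symm (.nil _)⟩

section cover2

variable [Fintype E] [DecidableEq E] {G : Multigraph V E} {T : Finset E}

lemma reach_same [Fintype V] (hT : G.IsSpanningTree T) (u v : V) (τ : {τ : Finset E // τ ⊆ Tᶜ}) :
    Nonempty ((cover G T).Walk (u, τ) (v, τ)) := by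
  obtain ⟨q, hq⟩ := hT.1 u v
  obtain ⟨τ', p, hp⟩ := lift q τ
  have : τ' = τ := by
    apply Subtype.ext
    ext e
    by_cases he : e ∈ T
    · have h1 : e ∉ τ.1 := fun h => by simpa [he] using τ.2 h
      have h2 : e ∉ τ'.1 := fun h => by simpa [he] using τ'.2 h
      simp [h1, h2]
    · have h1 := count_proj p e he
      rw [hp, List.count_eq_zero.2 (fun h => he (hq e h))] at h1
      unfold ind at h1
      by_cases h3 : e ∈ τ.1 <;> by_cases h4 : e ∈ τ'.1 <;> simp [h3, h4] at h1 ⊢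
  subst this
  exact ⟨p⟩

lemma cover_connected [Fintype V] (hT : G.IsSpanningTree T) : (cover G T).Connected := by
  have key : ∀ (k : ℕ) (u v : V) (τ : {τ : Finset E // τ ⊆ Tᶜ}), τ.1.card = k →
      Nonempty ((cover G T).Walk (u, τ) (v, ⟨∅, by simp⟩)) := by
    intro k
    induction k with
    | zero =>
      intro u v τ h
      have : τ = ⟨∅, by simp⟩ := Subtype.ext (Finset.card_eq_zero.1 h)
      rw [this]
      exact reach_same hT _ _ _
    | succ k ih =>
      intro u v τ h
      obtain ⟨e, he⟩ : τ.1.Nonempty := Finset.card_pos.1 (by omega)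
      have heT : e ∉ T := by simpa using τ.2 he
      have hc : (tauStep T e τ).1 = τ.1.erase e := by
        ext a
        rw [mem_tauStep, Finset.mem_erase]
        by_cases h1 : e = a
        · subst h1; simp [heT, he]
        · simp [h1, Ne.symm h1]
      refine reach_trans (reach_same hT u (G.src e) τ) ?_
      refine reach_trans ⟨.cons (v := (G.tgt e, tauStep T e τ)) (e, τ)
        (Or.inl ⟨rfl, rfl⟩) (.nil _)⟩ ?_
      exact ih _ _ _ (by rw [hc, Finset.card_erase_of_mem he, h]; rfl)
  rintro ⟨u, τ⟩ ⟨v, τ'⟩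
  exact reach_trans (key _ u u τ rfl) (reach_symm (key _ v u τ' rfl))

/-- no nonempty even edge set with at most `g` edges -/
def NoSmall (G : Multigraph V E) (g : ℕ) : Prop :=
  ∀ m : Multiset E, m.Nodup → bd G m = 0 → m.card ≤ g → m = 0

lemma split_walk {G : Multigraph V E} {u v : V} (q : G.Walk u v) (f : E) (hf : f ∈ q.edges) :
    ∃ (z w : V) (a : G.Walk u z) (b : G.Walk w v), G.EndsAt f z w ∧
      q.edges = a.edges ++ f :: b.edges := by
  induction q with
  | nil v => simp [Walk.edges] at hf
  | @cons u v w e h q ih =>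
    by_cases hef : f = e
    · subst hef
      exact ⟨_, _, .nil _, q, h, rfl⟩
    · have : f ∈ q.edges := by simpa [Walk.edges, hef] using hf
      obtain ⟨z, w', a, b, h1, h2⟩ := ih this
      exact ⟨z, w', .cons e h a, b, h1, by simp [Walk.edges, h2]⟩

lemma no_loop {g : ℕ} (hg : NoSmall G g) (h1 : 1 ≤ g) (e : E) : G.src e ≠ G.tgt e := by
  intro h
  have := hg {e} (Multiset.nodup_singleton e) (by simp [bd, dE, h, add_self2]) (by simpa using h1)
  simp at this

lemma proj_nodup {g : ℕ} (hg : NoSmall G g) {x y} (q : (cover G T).Walk x y)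
    (hn : q.edges.Nodup) (hl : q.edges.length ≤ g) : (q.edges.map Prod.fst).Nodup := by
  induction q with
  | nil v => simp [Walk.edges]
  | @cons x x' y f h q ih =>
    simp only [Walk.edges, List.nodup_cons, List.length_cons, List.map_cons] at hn hl ⊢
    have hq := ih hn.2 (by omega)
    refine ⟨?_, hq⟩
    intro hmem
    obtain ⟨f', hf', hff⟩ := List.mem_map.1 hmem
    obtain ⟨z, w, a, b, hzw, hsp⟩ := split_walk q f' hf'
    have hloop := no_loop hg (by omega) f.1
    have hne : f' ≠ f := fun h => hn.1 (h ▸ hf')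
    have hadd := hq
    rw [hsp, List.map_append, List.map_cons, List.nodup_append] at hadd
    obtain ⟨han, _, had⟩ := hadd
    have hal : a.edges.length < q.edges.length := by rw [hsp]; simp
    obtain ⟨e, τ⟩ := f
    obtain ⟨e', τ'⟩ := f'
    simp only at hff hloop
    subst hff
    have hba := bd_proj a
    by_cases hz : z.1 = x'.1
    · have h0 := hg _ (Multiset.coe_nodup.2 han) (by rw [hba, hz, add_self2])
        (by simp; omega)
      have hzx : z = x' := by
        cases a with
        | nil => rfl
        | cons => simp [Walk.edges] at h0
      subst hzx
      rcases h with ⟨h1, h2⟩ | ⟨h1, h2⟩ <;> rcases hzw with ⟨h3, h4⟩ | ⟨h3, h4⟩ <;>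
        simp only [cover] at h1 h2 h3 h4
      · exact hloop ((congrArg Prod.fst h3).trans (congrArg Prod.fst h2).symm)
      · have := congrArg Prod.snd (h2.trans h4.symm)
        exact hne (by rw [tauStep_inj _ this])
      · have := congrArg Prod.snd (h1.trans h3.symm)
        simp only at this
        exact hne (by rw [this])
      · exact hloop ((congrArg Prod.fst h1).trans (congrArg Prod.fst h4).symm)
    · have hends : G.EndsAt e' x.1 x'.1 ∧ z.1 = x.1 := by
        rcases h with ⟨h1, h2⟩ | ⟨h1, h2⟩ <;> rcases hzw with ⟨h3, h4⟩ | ⟨h3, h4⟩ <;>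
          subst h1 <;> subst h2 <;> subst h3 <;> subst h4 <;> simp [cover, EndsAt] at hz ⊢
      have h0 := hg (e' ::ₘ ((a.edges.map Prod.fst : List E) : Multiset E)) ?_ ?_ ?_
      · simp at h0
      · rw [Multiset.nodup_cons]
        refine ⟨?_, Multiset.coe_nodup.2 han⟩
        intro hm
        exact had e' (by simpa using hm) e' (by simp) rfl
      · rw [bd_cons, dE_of_ends hends.1, hba, hends.2, add_comm (dl x.1) (dl x'.1), add_self2]
      · simp; omega

lemma noSmall_step [Fintype V] (hT : G.IsSpanningTree T) {g : ℕ} (hg : NoSmall G g) :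
    NoSmall (cover G T) (g + 1) := by
  intro m hn hb hc
  by_contra hm
  obtain ⟨f, hf⟩ := Multiset.exists_mem_of_ne_zero hm
  have hm' := Multiset.cons_erase hf
  have hb' : bd (cover G T) (m.erase f) =
      dl ((cover G T).tgt f) + dl ((cover G T).src f) := by
    rw [← hm', bd_cons] at hb
    rw [← eq_of_add2 hb, dE, add_comm]
  obtain ⟨q, hq⟩ := trail _ _ _ _ _ rfl hb'
  have hqn : q.edges.Nodup := Multiset.coe_nodup.1
    (Multiset.nodup_of_le (hq.trans (Multiset.erase_le _ _)) hn)
  have hql : q.edges.length ≤ g := by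
    have := Multiset.card_le_card hq
    rw [Multiset.card_erase_of_mem hf] at this
    simp at this
    omega
  have hfq : f ∉ q.edges := by
    intro h
    have h1 : f ∈ m.erase f := Multiset.mem_of_le hq (by simpa using h)
    exact (Multiset.Nodup.mem_erase_iff hn).1 h1 |>.1 rfl
  have hpn := proj_nodup hg q hqn hql
  have hpar := fun e => parity hT (Walk.cons f (Or.inl ⟨rfl, rfl⟩) q) (.nil _) e
  simp only [Walk.edges, List.map_cons, List.map_nil, List.count_nil, List.count_cons] at hpar
  have hle := fun e => List.nodup_iff_count_le_one.1 hpn e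
  have hcnt : ∀ e ∈ q.edges.map Prod.fst, e = f.1 := by
    intro e he
    by_contra hne
    have h1 := hpar e
    have h2 : (q.edges.map Prod.fst).count e = 1 := List.count_eq_one_of_mem hpn he
    rw [h2] at h1
    simp [Ne.symm hne] at h1
  have hin : f.1 ∈ q.edges.map Prod.fst := by
    by_contra hnin
    have h1 := hpar f.1
    rw [List.count_eq_zero.2 hnin] at h1
    simp at h1
  have hlist : q.edges.map Prod.fst = [f.1] := by
    revert hpn hcnt hin
    generalize q.edges.map Prod.fst = l
    intro hpn hcnt hin
    match l with
    | [] => simp at hin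
    | [a] => simp [hcnt a (by simp)]
    | a :: b :: l =>
      have h1 := hcnt a (by simp)
      have h2 := hcnt b (by simp)
      simp [h1, h2] at hpn
  have hloop := no_loop hg (by have := congrArg List.length hlist; simp at this; omega) f.1
  revert hlist hfq
  clear hpar hle hcnt hin hpn hql hqn hq
  generalize hA : (cover G T).tgt f = A at q
  generalize hB : (cover G T).src f = B at q
  intro hfq hlist
  cases q with
  | nil => simp [Walk.edges] at hlist
  | cons f' h q =>
    cases q with
    | cons => simp [Walk.edges] at hlist
    | nil =>
      simp only [Walk.edges, List.map_cons, List.map_nil, List.cons.injEq, and_true,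
        List.mem_singleton] at hlist hfq
      obtain ⟨e, τ⟩ := f
      obtain ⟨e', τ'⟩ := f'
      simp only at hlist hloop
      subst hlist
      subst hA
      subst hB
      rcases h with ⟨h1, h2⟩ | ⟨h1, h2⟩
      · exact hloop (congrArg Prod.fst h1)
      · have := congrArg Prod.snd h1
        simp only [cover] at this
        exact hfq (by rw [this])

lemma graphDist_le {V E : Type} {G : Multigraph V E} {u v : V} (p : G.Walk u v) :
    graphDist G u v ≤ p.length := Nat.sInf_le ⟨p, rfl⟩

lemma exists_geod {V E : Type} {G : Multigraph V E} (hG : G.Connected) (u v : V) :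
    ∃ p : G.Walk u v, p.length = graphDist G u v := by
  obtain ⟨p⟩ := hG u v
  exact Nat.sInf_mem (s := {n : ℕ | ∃ p : G.Walk u v, p.length = n}) ⟨_, p, rfl⟩

lemma wall_le_graph (hG : (cover G T).Connected) (x y) :
    wallDist G T x y ≤ graphDist (cover G T) x y := by
  obtain ⟨p, hp⟩ := exists_geod hG x y
  rw [← hp, ← length_edges]
  have : {e : E | (cover G T).Separates (wallOf G T e) x y} ⊆
      ((p.edges.map Prod.fst).toFinset : Set E) := by
    intro e he
    by_contra hc
    apply he
    refine ⟨p, fun f hf hfe => hc ?_⟩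
    simp only [List.coe_toFinset, Set.mem_ofPred_eq]
    exact List.mem_map.2 ⟨f, hf, hfe⟩
  calc _ ≤ ((p.edges.map Prod.fst).toFinset : Set E).ncard :=
        Set.ncard_le_ncard this (Finset.finite_toSet _)
    _ ≤ _ := by
        rw [Set.ncard_coe_finset]
        exact (List.toFinset_card_le _).trans (by simp)

lemma graph_le_of_wall [Fintype V] (hT : G.IsSpanningTree T) {R : ℕ} (hg : NoSmall G R) (x y)
    (h : wallDist G T x y ≤ R) : graphDist (cover G T) x y ≤ R := by
  obtain ⟨p⟩ := cover_connected hT x y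
  set c : E → ZMod 2 := fun e => (((p.edges.map Prod.fst).count e : ℕ) : ZMod 2) with hc
  have h01 : ∀ a : ZMod 2, a ≠ 0 → a = 1 := by decide
  set F : Finset E := Finset.univ.filter (fun e => c e ≠ 0) with hF
  have hFc : ∀ e, ((F.val.count e : ℕ) : ZMod 2) = c e := by
    intro e
    rw [Multiset.count_eq_of_nodup F.nodup]
    by_cases he : c e = 0
    · simp [hF, he]
    · simp [hF, h01 _ he]
  have hbF : bd G F.val = dl x.1 + dl y.1 := by
    rw [← bd_proj p, bd_eq, bd_eq]
    simp only [hFc, hc, Multiset.coe_count]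
  have hFR : F.card ≤ R := by
    refine le_trans ?_ h
    rw [← Set.ncard_coe_finset]
    refine Set.ncard_le_ncard ?_ (Set.toFinite _)
    intro e he hsep
    obtain ⟨p', hp'⟩ := hsep
    have h1 : c e ≠ 0 := by simpa [hF] using he
    apply h1
    simp only [hc]
    rw [parity hT p p' e, List.count_eq_zero.2, Nat.cast_zero]
    intro hm
    obtain ⟨f, hf, hfe⟩ := List.mem_map.1 hm
    exact hp' f hf hfe
  obtain ⟨q, hq⟩ := trail G _ F.val _ _ rfl hbF
  have hqF : F.val = (q.edges : Multiset E) := by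
    have h1 := add_tsub_cancel_of_le hq
    have h2 := hg (F.val - q.edges) (Multiset.nodup_of_le (Multiset.sub_le_self _ _) F.nodup) ?_ ?_
    · rw [h2] at h1
      simpa using h1.symm
    · have h3 := bd_walk q
      rw [← h1, bd_add, h3] at hbF
      simpa using hbF
    · exact (Multiset.card_le_card (Multiset.sub_le_self _ _)).trans hFR
  obtain ⟨τ', p', hp'⟩ := lift q x.2
  have hτ : τ' = y.2 := by
    apply Subtype.ext
    ext e
    by_cases he : e ∈ T
    · have h1 : e ∉ y.2.1 := fun h => by simpa [he] using y.2.2 h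
      have h2 : e ∉ τ'.1 := fun h => by simpa [he] using τ'.2 h
      simp [h1, h2]
    · have h1 := count_proj p' e he
      have h2 := count_proj p e he
      rw [hp', ← Multiset.coe_count, ← hqF, hFc] at h1
      have h3 : ind e τ' = ind e y.2 := add_left_cancel (h1.symm.trans h2)
      unfold ind at h3
      by_cases h4 : e ∈ y.2.1 <;> by_cases h5 : e ∈ τ'.1 <;> simp [h4, h5] at h3 ⊢
  subst hτ
  refine (graphDist_le p').trans ?_
  rw [← length_edges]
  have h1 := congrArg List.length hp'
  have h2 := congrArg Multiset.card hqF
  simp at h1 h2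
  omega

end cover2

noncomputable instance (n : ℕ) : Fintype (lv n).V := (lv n).fV
noncomputable instance (n : ℕ) : Fintype (lv n).E := (lv n).fE
noncomputable instance (n : ℕ) : DecidableEq (lv n).V := (lv n).dV
noncomputable instance (n : ℕ) : DecidableEq (lv n).E := (lv n).dE

lemma chooseTree_spec {V E : Type} [Fintype V] [Fintype E] {G : Multigraph V E}
    (h : ∃ T : Finset E, G.IsSpanningTree T) : G.IsSpanningTree (chooseTree G) := by
  unfold chooseTree
  simp only [dif_pos h]
  exact h.choose_spec

lemma lv_all (n : ℕ) : Nonempty (lv n).V ∧ (lv n).G.Connected ∧ NoSmall (lv n).G n := by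
  induction n with
  | zero =>
    refine ⟨⟨()⟩, fun u v => ⟨.nil _⟩, ?_⟩
    intro m _ _ h
    exact Multiset.card_eq_zero.1 (by omega)
  | succ n ih =>
    obtain ⟨h1, h2, h3⟩ := ih
    have hT := chooseTree_spec (exists_tree (lv n).G h2)
    have hc := cover_connected hT
    have hs := noSmall_step hT h3
    refine ⟨?_, hc, hs⟩
    obtain ⟨v⟩ := h1
    exact ⟨((v, ⟨∅, Finset.empty_subset _⟩) : (lv n).V × {τ : Finset (lv n).E // τ ⊆ (chooseTree (lv n).G)ᶜ})⟩

lemma lv_tree (n : ℕ) : (lv n).G.IsSpanningTree (chooseTree (lv n).G) := by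
  obtain ⟨h1, h2, h3⟩ := lv_all n
  exact chooseTree_spec (exists_tree (lv n).G h2)

lemma wallAt_le (n : ℕ) (x y : (lv n).V) : wallDistAt n x y ≤ graphDistAt n x y := by
  cases n with
  | zero => exact Nat.zero_le _
  | succ n => exact wall_le_graph (cover_connected (lv_tree n)) x y

lemma bdd {α : Type} [Finite α] (f : α → α → ℕ) : BddAbove {k : ℕ | ∃ x y, f x y = k} := by
  apply Set.Finite.bddAbove
  have : {k : ℕ | ∃ x y, f x y = k} = Set.range (fun p : α × α => f p.1 p.2) := by
    ext k; simp
  rw [this]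
  exact Set.finite_range _

lemma le_diamX (n : ℕ) (x y : (lv n).V) : graphDistAt n x y ≤ diamX n :=
  le_csSup (bdd _) ⟨x, y, rfl⟩

lemma diamW_le (n : ℕ) : diamW n ≤ diamX n := by
  obtain ⟨v⟩ := (lv_all n).1
  refine csSup_le (s := {k : ℕ | ∃ x y, wallDistAt n x y = k}) ⟨_, v, v, rfl⟩ ?_
  rintro k ⟨x, y, rfl⟩
  exact (wallAt_le n x y).trans (le_diamX n x y)

end BoxAux

/-- The identity map `(X, d_X) → (X, d_W)` on the box space is a coarse equivalence;
precisely, it is `1`-Lipschitz (`d_W ≤ d_X`), and for every `R ≥ 0` there is `S ≥ 0`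
such that `d_W(x,y) ≤ R` implies `d_X(x,y) ≤ S`. -/
theorem id_coarse_equivalence_graph_wall :
    (∀ p q : BoxV, boxDistW p q ≤ boxDistX p q) ∧
    (∀ R : ℕ, ∃ S : ℕ, ∀ p q : BoxV, boxDistW p q ≤ R → boxDistX p q ≤ S) := by

  constructor
  · rintro ⟨n, x⟩ ⟨m, y⟩
    unfold boxDistW boxDistX
    by_cases h : n = m
    · subst h
      simpa using BoxAux.wallAt_le n x y
    · simp only [h, dite_false]
      have h1 := BoxAux.diamW_le n
      have h2 := BoxAux.diamW_le m
      omega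
  · intro R
    refine ⟨R + 2 * ∑ i ∈ Finset.range (R + 1), diamX i, ?_⟩
    have hD : ∀ n ≤ R, diamX n ≤ ∑ i ∈ Finset.range (R + 1), diamX i := fun n hn =>
      Finset.single_le_sum (f := diamX) (fun _ _ => Nat.zero_le _)
        (Finset.mem_range.2 (by omega))
    rintro ⟨n, x⟩ ⟨m, y⟩
    unfold boxDistW boxDistX
    by_cases h : n = m
    · subst h
      simp only [dite_true]
      intro hW
      by_cases hn : n ≤ R
      · have h1 := hD n hn
        have h2 := BoxAux.le_diamX n x y
        omega
      · obtain ⟨k, rfl⟩ : ∃ k, n = k + 1 := ⟨n - 1, by omega⟩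
        have hg : BoxAux.NoSmall (lv k).G R := fun mm h1 h2 h3 =>
          (BoxAux.lv_all k).2.2 mm h1 h2 (by omega)
        have := BoxAux.graph_le_of_wall (BoxAux.lv_tree k) hg x y hW
        exact le_trans this (by omega)
    · simp only [h, dite_false]
      intro hW
      have h1 := hD n (by omega)
      have h2 := hD m (by omega)
      omega
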